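/- arXiv:1904.08470 — 2 statements merged into one kernel-verified Lean document; each statement's English description precedes it below -/
import Mathlib

section
/- The alternating bilinear bracket on the 40-dimensional complex vector space with basis $u_1,\dots,u_{40}$ determined by the relations listed in the context (all other brackets of basis elements $[u_i,u_j]$ with $i>j$ being zero) satisfies the Jacobi identity, and hence defines a complex Lie algebra $\widetilde{\mathfrak{n}}(A_4)$. -/
open Fin.NatCast in
/-- The basis vector `u k` (1-based index `k`) of `ℂ^40`. -/
noncomputable def u (k : ℕ) : Fin 40 → ℂ := Pi.single ((k - 1 : ℕ) : Fin 40) 1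

/-- Structure constants: `cUp i j` is the value of `[u i, u j]` for `i > j` (1-based). -/
noncomputable def cUp : ℕ → ℕ → (Fin 40 → ℂ)
  | 2, 1 => u 6 - u 5
  | 3, 2 => u 8 - u 7
  | 4, 3 => u 10 - u 9
  | 5, 3 => u 11 - u 13
  | 6, 3 => u 14 - u 12
  | 7, 1 => u 14 - u 11
  | 7, 4 => u 15 - u 17
  | 7, 5 => u 19
  | 8, 1 => u 12 - u 13
  | 8, 4 => u 18 - u 16
  | 8, 6 => -u 19
  | 9, 2 => u 18 - u 15
  | 9, 5 => u 23 - u 21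
  | 9, 6 => u 27 - u 25
  | 9, 7 => u 20
  | 10, 2 => u 16 - u 17
  | 10, 5 => u 24 - u 22
  | 10, 6 => u 28 - u 26
  | 10, 8 => -u 20
  | 11, 4 => u 21 - u 22
  | 11, 9 => -u 32
  | 12, 4 => u 27 - u 28
  | 12, 10 => u 31
  | 13, 2 => -u 19
  | 13, 4 => u 23 - u 24
  | 13, 10 => u 32
  | 14, 2 => u 19
  | 14, 4 => u 25 - u 26
  | 14, 9 => -u 31
  | 15, 1 => u 25 - u 21
  | 15, 5 => u 29
  | 15, 11 => u 37
  | 15, 13 => u 33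
  | 16, 1 => u 28 - u 24
  | 16, 6 => -u 30
  | 16, 12 => -u 38
  | 16, 14 => -u 34
  | 17, 1 => u 26 - u 22
  | 17, 3 => -u 20
  | 17, 5 => u 30
  | 17, 12 => -u 35
  | 17, 13 => u 36 - u 34
  | 17, 14 => -u 37
  | 18, 1 => u 27 - u 23
  | 18, 3 => u 20
  | 18, 6 => -u 29
  | 18, 11 => u 36
  | 18, 13 => u 38
  | 18, 14 => u 33 - u 35
  | 19, 4 => u 29 - u 30
  | 19, 9 => u 33 - u 38
  | 19, 10 => u 37 - u 34
  | 20, 1 => u 31 - u 32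
  | 20, 5 => u 38 - u 36
  | 20, 6 => u 35 - u 37
  | 22, 3 => -u 32
  | 22, 7 => -u 37
  | 22, 8 => -u 36
  | 22, 12 => -u 39
  | 23, 2 => -u 29
  | 23, 3 => u 32
  | 23, 7 => u 33 - u 36
  | 23, 14 => -u 39
  | 23, 17 => u 40
  | 24, 2 => -u 30
  | 24, 7 => -u 34
  | 24, 8 => -u 38
  | 24, 15 => -u 40
  | 25, 2 => u 29
  | 25, 7 => u 37
  | 25, 8 => u 33
  | 25, 16 => u 40
  | 26, 2 => u 30
  | 26, 3 => -u 31
  | 26, 8 => u 35 - u 34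
  | 26, 13 => u 39
  | 26, 18 => -u 40
  | 27, 3 => u 31
  | 27, 7 => u 35
  | 27, 8 => u 38
  | 27, 11 => u 39
  | 29, 3 => u 37 - u 33
  | 29, 10 => -u 40
  | 30, 3 => u 34 - u 38
  | 30, 9 => u 40
  | 31, 2 => u 38 - u 35
  | 31, 5 => -u 39
  | 32, 2 => u 36 - u 37
  | 32, 6 => u 39
  | 33, 4 => -u 40
  | 34, 4 => u 40
  | 35, 1 => -u 39
  | 36, 1 => u 39
  | _, _ => 0

/-- Antisymmetric extension of the structure constants. -/
noncomputable def c (i j : ℕ) : Fin 40 → ℂ :=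
  if j < i then cUp i j else if i < j then -cUp j i else 0

/-- The bilinear bracket on `ℂ^40` determined by the structure constants. -/
noncomputable def br (x y : Fin 40 → ℂ) : Fin 40 → ℂ :=
  ∑ i : Fin 40, ∑ j : Fin 40, (x i * y j) • c ((i : ℕ) + 1) ((j : ℕ) + 1)

/-- Combinatorial form of the structure constants: the pair `(P, N)` stands for
`∑_{a ∈ P} u a - ∑_{a ∈ N} u a`. -/
def tUp : ℕ → ℕ → List ℕ × List ℕ
  | 2, 1 => ([6], [5])
  | 3, 2 => ([8], [7])
  | 4, 3 => ([10], [9])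
  | 5, 3 => ([11], [13])
  | 6, 3 => ([14], [12])
  | 7, 1 => ([14], [11])
  | 7, 4 => ([15], [17])
  | 7, 5 => ([19], [])
  | 8, 1 => ([12], [13])
  | 8, 4 => ([18], [16])
  | 8, 6 => ([], [19])
  | 9, 2 => ([18], [15])
  | 9, 5 => ([23], [21])
  | 9, 6 => ([27], [25])
  | 9, 7 => ([20], [])
  | 10, 2 => ([16], [17])
  | 10, 5 => ([24], [22])
  | 10, 6 => ([28], [26])
  | 10, 8 => ([], [20])
  | 11, 4 => ([21], [22])
  | 11, 9 => ([], [32])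
  | 12, 4 => ([27], [28])
  | 12, 10 => ([31], [])
  | 13, 2 => ([], [19])
  | 13, 4 => ([23], [24])
  | 13, 10 => ([32], [])
  | 14, 2 => ([19], [])
  | 14, 4 => ([25], [26])
  | 14, 9 => ([], [31])
  | 15, 1 => ([25], [21])
  | 15, 5 => ([29], [])
  | 15, 11 => ([37], [])
  | 15, 13 => ([33], [])
  | 16, 1 => ([28], [24])
  | 16, 6 => ([], [30])
  | 16, 12 => ([], [38])
  | 16, 14 => ([], [34])
  | 17, 1 => ([26], [22])
  | 17, 3 => ([], [20])
  | 17, 5 => ([30], [])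
  | 17, 12 => ([], [35])
  | 17, 13 => ([36], [34])
  | 17, 14 => ([], [37])
  | 18, 1 => ([27], [23])
  | 18, 3 => ([20], [])
  | 18, 6 => ([], [29])
  | 18, 11 => ([36], [])
  | 18, 13 => ([38], [])
  | 18, 14 => ([33], [35])
  | 19, 4 => ([29], [30])
  | 19, 9 => ([33], [38])
  | 19, 10 => ([37], [34])
  | 20, 1 => ([31], [32])
  | 20, 5 => ([38], [36])
  | 20, 6 => ([35], [37])
  | 22, 3 => ([], [32])
  | 22, 7 => ([], [37])
  | 22, 8 => ([], [36])
  | 22, 12 => ([], [39])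
  | 23, 2 => ([], [29])
  | 23, 3 => ([32], [])
  | 23, 7 => ([33], [36])
  | 23, 14 => ([], [39])
  | 23, 17 => ([40], [])
  | 24, 2 => ([], [30])
  | 24, 7 => ([], [34])
  | 24, 8 => ([], [38])
  | 24, 15 => ([], [40])
  | 25, 2 => ([29], [])
  | 25, 7 => ([37], [])
  | 25, 8 => ([33], [])
  | 25, 16 => ([40], [])
  | 26, 2 => ([30], [])
  | 26, 3 => ([], [31])
  | 26, 8 => ([35], [34])
  | 26, 13 => ([39], [])
  | 26, 18 => ([], [40])
  | 27, 3 => ([31], [])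
  | 27, 7 => ([35], [])
  | 27, 8 => ([38], [])
  | 27, 11 => ([39], [])
  | 29, 3 => ([37], [33])
  | 29, 10 => ([], [40])
  | 30, 3 => ([34], [38])
  | 30, 9 => ([40], [])
  | 31, 2 => ([38], [35])
  | 31, 5 => ([], [39])
  | 32, 2 => ([36], [37])
  | 32, 6 => ([39], [])
  | 33, 4 => ([], [40])
  | 34, 4 => ([40], [])
  | 35, 1 => ([], [39])
  | 36, 1 => ([39], [])
  | _, _ => ([], [])

/-- The vector encoded by a pair of lists. -/
noncomputable def ev (v : List ℕ × List ℕ) : Fin 40 → ℂ :=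
  (v.1.map u).sum - (v.2.map u).sum

/-- Antisymmetric extension of `tUp`. -/
def tC (i j : ℕ) : List ℕ × List ℕ :=
  if j < i then tUp i j else if i < j then (tUp j i).swap else ([], [])

theorem ev0 : 0 = ev ([], []) := by simp [ev]
theorem ev1 (a) : u a = ev ([a], []) := by simp [ev]
theorem ev2 (a) : -u a = ev ([], [a]) := by simp [ev]
theorem ev3 (a b) : u a - u b = ev ([a], [b]) := by simp [ev]


set_option maxHeartbeats 8000000 in
theorem cUp_eq (i j : ℕ) (hi : i ≤ 40) (hj : j ≤ 40) : cUp i j = ev (tUp i j) := by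
  interval_cases i <;> interval_cases j <;>
    first | exact ev0 | exact ev3 _ _ | exact ev1 _ | exact ev2 _

theorem tUp_range : ∀ i ≤ 40, ∀ j ≤ 40,
    (∀ a ∈ (tUp i j).1, 1 ≤ a ∧ a ≤ 40) ∧ (∀ a ∈ (tUp i j).2, 1 ≤ a ∧ a ≤ 40) := by
  decide +kernel

theorem ev_swap (v : List ℕ × List ℕ) : ev v.swap = - ev v := by
  simp [ev]

theorem c_eq (i j : ℕ) (hi : i ≤ 40) (hj : j ≤ 40) : c i j = ev (tC i j) := by
  unfold c tC
  by_cases h : j < i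
  · simp [h, cUp_eq i j hi hj]
  · by_cases h' : i < j
    · simp [h, h', cUp_eq j i hj hi, ev_swap]
    · simp [h, h', ev]

theorem tC_range (i j : ℕ) (hi : i ≤ 40) (hj : j ≤ 40) :
    (∀ a ∈ (tC i j).1, 1 ≤ a ∧ a ≤ 40) ∧ (∀ a ∈ (tC i j).2, 1 ≤ a ∧ a ≤ 40) := by
  unfold tC
  split_ifs
  · exact tUp_range i hi j hj
  · exact (tUp_range j hj i hi).symm
  · simp

/-- The bracket as a bilinear map. -/
noncomputable def B : (Fin 40 → ℂ) →ₗ[ℂ] (Fin 40 → ℂ) →ₗ[ℂ] (Fin 40 → ℂ) :=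
  LinearMap.mk₂ ℂ br
    (by intro x y z; simp [br, add_mul, add_smul, Finset.sum_add_distrib])
    (by intro r x y; simp [br, mul_assoc, mul_smul, Finset.smul_sum])
    (by intro x y z; simp [br, mul_add, add_smul, Finset.sum_add_distrib])
    (by intro r x y; simp [br, mul_left_comm, mul_smul, Finset.smul_sum])

theorem B_apply (x y : Fin 40 → ℂ) : B x y = br x y := rfl

theorem u_succ (i : Fin 40) : u ((i : ℕ) + 1) = Pi.single i 1 := by
  simp [u]

theorem br_single (i j : Fin 40) :
    br (Pi.single i 1) (Pi.single j 1) = c ((i : ℕ) + 1) ((j : ℕ) + 1) := by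
  unfold br
  rw [Finset.sum_eq_single i, Finset.sum_eq_single j]
  · simp
  · intro b _ hb; simp [hb]
  · simp
  · intro b _ hb; simp [hb]
  · simp

theorem B_u (a b : ℕ) (ha : 1 ≤ a ∧ a ≤ 40) (hb : 1 ≤ b ∧ b ≤ 40) :
    B (u a) (u b) = c a b := by
  obtain ⟨a, rfl⟩ := Nat.exists_eq_add_of_le' ha.1
  obtain ⟨b, rfl⟩ := Nat.exists_eq_add_of_le' hb.1
  have h := br_single ⟨a, by omega⟩ ⟨b, by omega⟩
  rw [← u_succ, ← u_succ] at h
  exact h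

/-- Componentwise concatenation, encoding addition. -/
def app (v w : List ℕ × List ℕ) : List ℕ × List ℕ := (v.1 ++ w.1, v.2 ++ w.2)

theorem ev_app (v w : List ℕ × List ℕ) : ev (app v w) = ev v + ev w := by
  simp [ev, app]; abel

/-- Sum of the brackets `[u i, u a]` over `a` in a list. -/
def adL (i : ℕ) : List ℕ → List ℕ × List ℕ
  | [] => ([], [])
  | a :: l => app (tC i a) (adL i l)

/-- The bracket of `u i` with an encoded vector. -/
def ad (i : ℕ) (v : List ℕ × List ℕ) : List ℕ × List ℕ :=
  app (adL i v.1) (adL i v.2).swap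

theorem B_adL (i : ℕ) (hi : 1 ≤ i ∧ i ≤ 40) (l : List ℕ) (hl : ∀ a ∈ l, 1 ≤ a ∧ a ≤ 40) :
    B (u i) (l.map u).sum = ev (adL i l) := by
  induction l with
  | nil => simp [adL, ev]
  | cons a l ih =>
    rw [adL, ev_app, List.map_cons, List.sum_cons, map_add,
      ih (fun b hb => hl b (List.mem_cons_of_mem _ hb)), B_u i a hi (hl a List.mem_cons_self),
      c_eq i a hi.2 (hl a List.mem_cons_self).2]

theorem B_ad (i j k : ℕ) (hi : 1 ≤ i ∧ i ≤ 40) (hj : 1 ≤ j ∧ j ≤ 40) (hk : 1 ≤ k ∧ k ≤ 40) :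
    B (u i) (B (u j) (u k)) = ev (ad i (tC j k)) := by
  rw [B_u j k hj hk, c_eq j k hj.2 hk.2, ad, ev_app, ev_swap, ← B_adL i hi _ (tC_range j k hj.2 hk.2).1,
    ← B_adL i hi _ (tC_range j k hj.2 hk.2).2, ← sub_eq_add_neg, ← map_sub, ev]

/-- The encoded Jacobi sum of three basis vectors. -/
def jac (i j k : ℕ) : List ℕ × List ℕ :=
  app (app (ad i (tC j k)) (ad j (tC k i))) (ad k (tC i j))

/-- The positive and negative parts of the encoded Jacobi sum agree. -/
def jacOK (i j k : ℕ) : Bool := (jac i j k).1.isPerm (jac i j k).2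

theorem jac_all : ∀ k < 40, ∀ j < k + 1, ∀ i < j + 1, jacOK (i + 1) (j + 1) (k + 1) = true := by
  decide +kernel

theorem ev_eq_zero (v : List ℕ × List ℕ) (h : v.1.isPerm v.2 = true) : ev v = 0 := by
  have h' := List.isPerm_iff.1 h
  rw [ev, (h'.map u).sum_eq, sub_self]

theorem jacobi_single_of_le (i j k : Fin 40) (hij : i ≤ j) (hjk : j ≤ k) :
    B (Pi.single i 1) (B (Pi.single j 1) (Pi.single k 1))
      + B (Pi.single j 1) (B (Pi.single k 1) (Pi.single i 1))
      + B (Pi.single k 1) (B (Pi.single i 1) (Pi.single j 1)) = 0 := by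
  have r (m : Fin 40) : 1 ≤ (m : ℕ) + 1 ∧ (m : ℕ) + 1 ≤ 40 := by omega
  simp only [← u_succ]
  rw [B_ad _ _ _ (r i) (r j) (r k), B_ad _ _ _ (r j) (r k) (r i), B_ad _ _ _ (r k) (r i) (r j),
    ← ev_app, ← ev_app]
  exact ev_eq_zero _ (jac_all k k.2 j (Nat.lt_succ_of_le hjk) i (Nat.lt_succ_of_le hij))

theorem c_swap (i j : ℕ) : c i j = - c j i := by
  unfold c
  rcases lt_trichotomy i j with h | h | h
  · simp [h, h.not_gt]
  · simp [h]
  · simp [h, h.not_gt]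

theorem br_self (x : Fin 40 → ℂ) : br x x = 0 := by
  have h : br x x = - br x x := by
    conv_lhs => rw [br, Finset.sum_comm]
    rw [br, ← Finset.sum_neg_distrib]
    refine Finset.sum_congr rfl fun i _ => ?_
    rw [← Finset.sum_neg_distrib]
    refine Finset.sum_congr rfl fun j _ => ?_
    rw [c_swap, smul_neg, mul_comm]
  exact self_eq_neg.1 h

theorem B_swap (x y : Fin 40 → ℂ) : B x y = - B y x := by
  have h := br_self (x + y)
  have hx : B x x = 0 := br_self x
  have hy : B y y = 0 := br_self y
  rw [← B_apply] at h
  simp only [map_add, LinearMap.add_apply, hx, hy, zero_add, add_zero] at h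
  first
    | exact eq_neg_of_add_eq_zero_left h
    | exact eq_neg_of_add_eq_zero_right h

theorem jacobi_swap (x y z : Fin 40 → ℂ)
    (h : B x (B y z) + B y (B z x) + B z (B x y) = 0) :
    B y (B x z) + B x (B z y) + B z (B y x) = 0 := by
  rw [B_swap x z, B_swap z y, B_swap y x, map_neg, map_neg, map_neg, ← neg_eq_zero, ← h]
  abel

theorem jacobi_rot (x y z : Fin 40 → ℂ)
    (h : B x (B y z) + B y (B z x) + B z (B x y) = 0) :
    B y (B z x) + B z (B x y) + B x (B y z) = 0 := by
  rw [← h]; abel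

theorem jacobi_single (i j k : Fin 40) :
    B (Pi.single i 1) (B (Pi.single j 1) (Pi.single k 1))
      + B (Pi.single j 1) (B (Pi.single k 1) (Pi.single i 1))
      + B (Pi.single k 1) (B (Pi.single i 1) (Pi.single j 1)) = 0 := by
  rcases le_total i j with hij | hij <;> rcases le_total j k with hjk | hjk <;>
    rcases le_total i k with hik | hik
  · exact jacobi_single_of_le i j k hij hjk
  · exact jacobi_single_of_le i j k hij hjk
  · exact jacobi_rot _ _ _ (jacobi_swap _ _ _ (jacobi_single_of_le i k j hik hjk))
  · exact jacobi_rot _ _ _ (jacobi_single_of_le k i j hik hij)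
  · exact jacobi_swap _ _ _ (jacobi_single_of_le j i k hij hik)
  · exact jacobi_rot _ _ _ (jacobi_rot _ _ _ (jacobi_single_of_le j k i hjk hik))
  · exact jacobi_rot _ _ _ (jacobi_rot _ _ _ (jacobi_swap _ _ _
      (jacobi_single_of_le k j i hjk hij)))
  · exact jacobi_rot _ _ _ (jacobi_rot _ _ _ (jacobi_swap _ _ _
      (jacobi_single_of_le k j i hjk hij)))

theorem jacobi_ext (y z : Fin 40 → ℂ)
    (h : ∀ i, B (Pi.single i 1) (B y z) + B y (B z (Pi.single i 1))
      + B z (B (Pi.single i 1) y) = 0) (x : Fin 40 → ℂ) :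
    B x (B y z) + B y (B z x) + B z (B x y) = 0 := by
  have key : B.flip (B y z) + (B y).comp (B z) + (B z).comp (B.flip y) = 0 := by
    refine (Pi.basisFun ℂ (Fin 40)).ext fun i => ?_
    simpa using h i
  simpa using congrArg (fun f => f x) key

theorem jacobi (x y z : Fin 40 → ℂ) :
    B x (B y z) + B y (B z x) + B z (B x y) = 0 := by
  refine jacobi_ext y z (fun i => ?_) x
  have h := jacobi_ext z (Pi.single i 1) (fun j => ?_) y
  · rw [← h]; abel
  have h := jacobi_ext (Pi.single i 1) (Pi.single j 1) (fun k => ?_) z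
  · rw [← h]; abel
  rw [← jacobi_single i j k]; abel

theorem stmt_10 :
    (∀ x : Fin 40 → ℂ, br x x = 0) ∧
    (∀ x y z : Fin 40 → ℂ,
      br x (br y z) + br y (br z x) + br z (br x y) = 0) := by
  exact ⟨br_self, jacobi⟩
end

section
/- The upper central series of $\widetilde{\mathfrak{n}}(A_4)$, defined by $\mathfrak{n}^0 = 0$ and $\mathfrak{n}^{i+1} = \{x : [x,y] \in \mathfrak{n}^i \text{ for all } y \in \widetilde{\mathfrak{n}}(A_4)\}$, has terms of dimensions $0, 8, 13, 22, 31, 40$, i.e. $\dim \mathfrak{n}^1 = 8$, $\dim \mathfrak{n}^2 = 13$, $\dim \mathfrak{n}^3 = 22$, $\dim \mathfrak{n}^4 = 31$, and $\mathfrak{n}^5 = \widetilde{\mathfrak{n}}(A_4)$; in particular the center of $\widetilde{\mathfrak{n}}(A_4)$ is $\mathfrak{n}^1 = \mathrm{span}\{u_{40},\ u_{39},\ u_{38},\ u_{37},\ u_{35}+u_{36},\ u_{33}+u_{34},\ u_{28},\ u_{21}\}$. -/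
/-- Upper central series: `ucs 0 = {0}`, `ucs (i+1) = {x | ∀ y, [x, y] ∈ ucs i}`. -/
noncomputable def ucs : ℕ → Set (Fin 40 → ℂ)
  | 0 => {0}
  | i + 1 => {x | ∀ y, br x y ∈ ucs i}


/-- Pairs (0-based) with a possibly nonzero structure constant. -/
def suppL : List (Fin 40 × Fin 40) :=
  [(1, 0), (2, 1), (3, 2), (4, 2), (5, 2), (6, 0), (6, 3), (6, 4), (7, 0), (7, 3), (7, 5),
    (8, 1), (8, 4), (8, 5), (8, 6), (9, 1), (9, 4), (9, 5), (9, 7), (10, 3), (10, 8), (11, 3),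
    (11, 9), (12, 1), (12, 3), (12, 9), (13, 1), (13, 3), (13, 8), (14, 0), (14, 4), (14, 10),
    (14, 12), (15, 0), (15, 5), (15, 11), (15, 13), (16, 0), (16, 2), (16, 4), (16, 11),
    (16, 12), (16, 13), (17, 0), (17, 2), (17, 5), (17, 10), (17, 12), (17, 13), (18, 3),
    (18, 8), (18, 9), (19, 0), (19, 4), (19, 5), (21, 2), (21, 6), (21, 7), (21, 11), (22, 1),
    (22, 2), (22, 6), (22, 13), (22, 16), (23, 1), (23, 6), (23, 7), (23, 14), (24, 1),
    (24, 6), (24, 7), (24, 15), (25, 1), (25, 2), (25, 7), (25, 12), (25, 17), (26, 2),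
    (26, 6), (26, 7), (26, 10), (28, 2), (28, 9), (29, 2), (29, 8), (30, 1), (30, 4), (31, 1),
    (31, 5), (32, 3), (33, 3), (34, 0), (35, 0)]

/-- The same pairs as a finset. -/
def supp : Finset (Fin 40 × Fin 40) := suppL.toFinset

set_option maxHeartbeats 0 in
theorem cUp_row_or (i j : Fin 40) :
    (i, j) ∈ suppL ∨ cUp ((i : ℕ) + 1) ((j : ℕ) + 1) = 0 := by
  fin_cases i <;> fin_cases j <;> first
    | exact Or.inl (by decide +kernel)
    | exact Or.inr rfl

theorem cUp_eq_zero (i j : Fin 40) (h : (i, j) ∉ supp) :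
    cUp ((i : ℕ) + 1) ((j : ℕ) + 1) = 0 :=
  (cUp_row_or i j).resolve_left fun h' => h (List.mem_toFinset.2 h')

theorem supp_lt (p : Fin 40 × Fin 40) (hp : p ∈ supp) : p.2 < p.1 := by
  have key : ∀ p ∈ suppL, p.2 < p.1 := by decide +kernel
  exact key p (List.mem_toFinset.1 hp)

theorem c_eq_s10 (i j : Fin 40) : c ((i : ℕ) + 1) ((j : ℕ) + 1) =
    (if (i, j) ∈ supp then cUp ((i : ℕ) + 1) ((j : ℕ) + 1) else 0)
    - (if (j, i) ∈ supp then cUp ((j : ℕ) + 1) ((i : ℕ) + 1) else 0) := by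
  unfold c
  by_cases h1 : (i, j) ∈ supp
  · have a := supp_lt _ h1
    have h2 : (j, i) ∉ supp := fun h => absurd (supp_lt _ h) (by simpa using a.le)
    have a' : (j : ℕ) < i := a
    simp [h1, h2, a']
  · by_cases h2 : (j, i) ∈ supp
    · have a := supp_lt _ h2
      have a' : (i : ℕ) < j := a
      have a2 : ¬ ((j : ℕ) < i) := by omega
      simp [h1, h2, a', a2]
    · simp [h1, h2, cUp_eq_zero _ _ h1, cUp_eq_zero _ _ h2]

theorem br_supp (x y : Fin 40 → ℂ) : br x y =
    ∑ p ∈ supp, (x p.1 * y p.2 - x p.2 * y p.1) • cUp ((p.1 : ℕ) + 1) ((p.2 : ℕ) + 1) := by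
  have e1 : ∀ f : Fin 40 → Fin 40 → ℂ, ∑ i : Fin 40, ∑ j : Fin 40, f i j •
      (if (i, j) ∈ supp then cUp ((i : ℕ) + 1) ((j : ℕ) + 1) else 0) =
      ∑ p ∈ supp, f p.1 p.2 • cUp ((p.1 : ℕ) + 1) ((p.2 : ℕ) + 1) := by
    intro f
    rw [← Fintype.sum_prod_type']
    simp [Finset.sum_ite_mem, smul_ite]
  unfold br
  simp only [c_eq_s10, smul_sub, Finset.sum_sub_distrib, sub_smul]
  rw [e1 (fun i j => x i * y j), Finset.sum_comm, e1 (fun i j => x j * y i)]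

/-- The bracket as an explicit sum over the nonzero structure constants. -/
theorem br_list (x y : Fin 40 → ℂ) : br x y = List.sum [
    (x 1 * y 0 - x 0 * y 1) • (u 6 - u 5),
    (x 2 * y 1 - x 1 * y 2) • (u 8 - u 7),
    (x 3 * y 2 - x 2 * y 3) • (u 10 - u 9),
    (x 4 * y 2 - x 2 * y 4) • (u 11 - u 13),
    (x 5 * y 2 - x 2 * y 5) • (u 14 - u 12),
    (x 6 * y 0 - x 0 * y 6) • (u 14 - u 11),
    (x 6 * y 3 - x 3 * y 6) • (u 15 - u 17),
    (x 6 * y 4 - x 4 * y 6) • (u 19),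
    (x 7 * y 0 - x 0 * y 7) • (u 12 - u 13),
    (x 7 * y 3 - x 3 * y 7) • (u 18 - u 16),
    (x 7 * y 5 - x 5 * y 7) • (-u 19),
    (x 8 * y 1 - x 1 * y 8) • (u 18 - u 15),
    (x 8 * y 4 - x 4 * y 8) • (u 23 - u 21),
    (x 8 * y 5 - x 5 * y 8) • (u 27 - u 25),
    (x 8 * y 6 - x 6 * y 8) • (u 20),
    (x 9 * y 1 - x 1 * y 9) • (u 16 - u 17),
    (x 9 * y 4 - x 4 * y 9) • (u 24 - u 22),
    (x 9 * y 5 - x 5 * y 9) • (u 28 - u 26),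
    (x 9 * y 7 - x 7 * y 9) • (-u 20),
    (x 10 * y 3 - x 3 * y 10) • (u 21 - u 22),
    (x 10 * y 8 - x 8 * y 10) • (-u 32),
    (x 11 * y 3 - x 3 * y 11) • (u 27 - u 28),
    (x 11 * y 9 - x 9 * y 11) • (u 31),
    (x 12 * y 1 - x 1 * y 12) • (-u 19),
    (x 12 * y 3 - x 3 * y 12) • (u 23 - u 24),
    (x 12 * y 9 - x 9 * y 12) • (u 32),
    (x 13 * y 1 - x 1 * y 13) • (u 19),
    (x 13 * y 3 - x 3 * y 13) • (u 25 - u 26),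
    (x 13 * y 8 - x 8 * y 13) • (-u 31),
    (x 14 * y 0 - x 0 * y 14) • (u 25 - u 21),
    (x 14 * y 4 - x 4 * y 14) • (u 29),
    (x 14 * y 10 - x 10 * y 14) • (u 37),
    (x 14 * y 12 - x 12 * y 14) • (u 33),
    (x 15 * y 0 - x 0 * y 15) • (u 28 - u 24),
    (x 15 * y 5 - x 5 * y 15) • (-u 30),
    (x 15 * y 11 - x 11 * y 15) • (-u 38),
    (x 15 * y 13 - x 13 * y 15) • (-u 34),
    (x 16 * y 0 - x 0 * y 16) • (u 26 - u 22),
    (x 16 * y 2 - x 2 * y 16) • (-u 20),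
    (x 16 * y 4 - x 4 * y 16) • (u 30),
    (x 16 * y 11 - x 11 * y 16) • (-u 35),
    (x 16 * y 12 - x 12 * y 16) • (u 36 - u 34),
    (x 16 * y 13 - x 13 * y 16) • (-u 37),
    (x 17 * y 0 - x 0 * y 17) • (u 27 - u 23),
    (x 17 * y 2 - x 2 * y 17) • (u 20),
    (x 17 * y 5 - x 5 * y 17) • (-u 29),
    (x 17 * y 10 - x 10 * y 17) • (u 36),
    (x 17 * y 12 - x 12 * y 17) • (u 38),
    (x 17 * y 13 - x 13 * y 17) • (u 33 - u 35),
    (x 18 * y 3 - x 3 * y 18) • (u 29 - u 30),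
    (x 18 * y 8 - x 8 * y 18) • (u 33 - u 38),
    (x 18 * y 9 - x 9 * y 18) • (u 37 - u 34),
    (x 19 * y 0 - x 0 * y 19) • (u 31 - u 32),
    (x 19 * y 4 - x 4 * y 19) • (u 38 - u 36),
    (x 19 * y 5 - x 5 * y 19) • (u 35 - u 37),
    (x 21 * y 2 - x 2 * y 21) • (-u 32),
    (x 21 * y 6 - x 6 * y 21) • (-u 37),
    (x 21 * y 7 - x 7 * y 21) • (-u 36),
    (x 21 * y 11 - x 11 * y 21) • (-u 39),
    (x 22 * y 1 - x 1 * y 22) • (-u 29),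
    (x 22 * y 2 - x 2 * y 22) • (u 32),
    (x 22 * y 6 - x 6 * y 22) • (u 33 - u 36),
    (x 22 * y 13 - x 13 * y 22) • (-u 39),
    (x 22 * y 16 - x 16 * y 22) • (u 40),
    (x 23 * y 1 - x 1 * y 23) • (-u 30),
    (x 23 * y 6 - x 6 * y 23) • (-u 34),
    (x 23 * y 7 - x 7 * y 23) • (-u 38),
    (x 23 * y 14 - x 14 * y 23) • (-u 40),
    (x 24 * y 1 - x 1 * y 24) • (u 29),
    (x 24 * y 6 - x 6 * y 24) • (u 37),
    (x 24 * y 7 - x 7 * y 24) • (u 33),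
    (x 24 * y 15 - x 15 * y 24) • (u 40),
    (x 25 * y 1 - x 1 * y 25) • (u 30),
    (x 25 * y 2 - x 2 * y 25) • (-u 31),
    (x 25 * y 7 - x 7 * y 25) • (u 35 - u 34),
    (x 25 * y 12 - x 12 * y 25) • (u 39),
    (x 25 * y 17 - x 17 * y 25) • (-u 40),
    (x 26 * y 2 - x 2 * y 26) • (u 31),
    (x 26 * y 6 - x 6 * y 26) • (u 35),
    (x 26 * y 7 - x 7 * y 26) • (u 38),
    (x 26 * y 10 - x 10 * y 26) • (u 39),
    (x 28 * y 2 - x 2 * y 28) • (u 37 - u 33),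
    (x 28 * y 9 - x 9 * y 28) • (-u 40),
    (x 29 * y 2 - x 2 * y 29) • (u 34 - u 38),
    (x 29 * y 8 - x 8 * y 29) • (u 40),
    (x 30 * y 1 - x 1 * y 30) • (u 38 - u 35),
    (x 30 * y 4 - x 4 * y 30) • (-u 39),
    (x 31 * y 1 - x 1 * y 31) • (u 36 - u 37),
    (x 31 * y 5 - x 5 * y 31) • (u 39),
    (x 32 * y 3 - x 3 * y 32) • (-u 40),
    (x 33 * y 3 - x 3 * y 33) • (u 40),
    (x 34 * y 0 - x 0 * y 34) • (-u 39),
    (x 35 * y 0 - x 0 * y 35) • (u 39)] := by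
  rw [br_supp, supp, List.sum_toFinset _ (by decide +kernel)]
  rfl

set_option maxHeartbeats 0 in
/-- The bracket in coordinates. -/
theorem br_eq (x y : Fin 40 → ℂ) : br x y = ![
    0,
    0,
    0,
    0,
    -(x 1 * y 0 - x 0 * y 1),
    (x 1 * y 0 - x 0 * y 1),
    -(x 2 * y 1 - x 1 * y 2),
    (x 2 * y 1 - x 1 * y 2),
    -(x 3 * y 2 - x 2 * y 3),
    (x 3 * y 2 - x 2 * y 3),
    (x 4 * y 2 - x 2 * y 4) - (x 6 * y 0 - x 0 * y 6),
    -(x 5 * y 2 - x 2 * y 5) + (x 7 * y 0 - x 0 * y 7),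
    -(x 4 * y 2 - x 2 * y 4) - (x 7 * y 0 - x 0 * y 7),
    (x 5 * y 2 - x 2 * y 5) + (x 6 * y 0 - x 0 * y 6),
    (x 6 * y 3 - x 3 * y 6) - (x 8 * y 1 - x 1 * y 8),
    -(x 7 * y 3 - x 3 * y 7) + (x 9 * y 1 - x 1 * y 9),
    -(x 6 * y 3 - x 3 * y 6) - (x 9 * y 1 - x 1 * y 9),
    (x 7 * y 3 - x 3 * y 7) + (x 8 * y 1 - x 1 * y 8),
    (x 6 * y 4 - x 4 * y 6) - (x 7 * y 5 - x 5 * y 7) - (x 12 * y 1 - x 1 * y 12) + (x 13 * y 1 - x 1 * y 13),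
    (x 8 * y 6 - x 6 * y 8) - (x 9 * y 7 - x 7 * y 9) - (x 16 * y 2 - x 2 * y 16) + (x 17 * y 2 - x 2 * y 17),
    -(x 8 * y 4 - x 4 * y 8) + (x 10 * y 3 - x 3 * y 10) - (x 14 * y 0 - x 0 * y 14),
    -(x 9 * y 4 - x 4 * y 9) - (x 10 * y 3 - x 3 * y 10) - (x 16 * y 0 - x 0 * y 16),
    (x 8 * y 4 - x 4 * y 8) + (x 12 * y 3 - x 3 * y 12) - (x 17 * y 0 - x 0 * y 17),
    (x 9 * y 4 - x 4 * y 9) - (x 12 * y 3 - x 3 * y 12) - (x 15 * y 0 - x 0 * y 15),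
    -(x 8 * y 5 - x 5 * y 8) + (x 13 * y 3 - x 3 * y 13) + (x 14 * y 0 - x 0 * y 14),
    -(x 9 * y 5 - x 5 * y 9) - (x 13 * y 3 - x 3 * y 13) + (x 16 * y 0 - x 0 * y 16),
    (x 8 * y 5 - x 5 * y 8) + (x 11 * y 3 - x 3 * y 11) + (x 17 * y 0 - x 0 * y 17),
    (x 9 * y 5 - x 5 * y 9) - (x 11 * y 3 - x 3 * y 11) + (x 15 * y 0 - x 0 * y 15),
    (x 14 * y 4 - x 4 * y 14) - (x 17 * y 5 - x 5 * y 17) + (x 18 * y 3 - x 3 * y 18) - (x 22 * y 1 - x 1 * y 22) + (x 24 * y 1 - x 1 * y 24),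
    -(x 15 * y 5 - x 5 * y 15) + (x 16 * y 4 - x 4 * y 16) - (x 18 * y 3 - x 3 * y 18) - (x 23 * y 1 - x 1 * y 23) + (x 25 * y 1 - x 1 * y 25),
    (x 11 * y 9 - x 9 * y 11) - (x 13 * y 8 - x 8 * y 13) + (x 19 * y 0 - x 0 * y 19) - (x 25 * y 2 - x 2 * y 25) + (x 26 * y 2 - x 2 * y 26),
    -(x 10 * y 8 - x 8 * y 10) + (x 12 * y 9 - x 9 * y 12) - (x 19 * y 0 - x 0 * y 19) - (x 21 * y 2 - x 2 * y 21) + (x 22 * y 2 - x 2 * y 22),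
    (x 14 * y 12 - x 12 * y 14) + (x 17 * y 13 - x 13 * y 17) + (x 18 * y 8 - x 8 * y 18) + (x 22 * y 6 - x 6 * y 22) + (x 24 * y 7 - x 7 * y 24) - (x 28 * y 2 - x 2 * y 28),
    -(x 15 * y 13 - x 13 * y 15) - (x 16 * y 12 - x 12 * y 16) - (x 18 * y 9 - x 9 * y 18) - (x 23 * y 6 - x 6 * y 23) - (x 25 * y 7 - x 7 * y 25) + (x 29 * y 2 - x 2 * y 29),
    -(x 16 * y 11 - x 11 * y 16) - (x 17 * y 13 - x 13 * y 17) + (x 19 * y 5 - x 5 * y 19) + (x 25 * y 7 - x 7 * y 25) + (x 26 * y 6 - x 6 * y 26) - (x 30 * y 1 - x 1 * y 30),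
    (x 16 * y 12 - x 12 * y 16) + (x 17 * y 10 - x 10 * y 17) - (x 19 * y 4 - x 4 * y 19) - (x 21 * y 7 - x 7 * y 21) - (x 22 * y 6 - x 6 * y 22) + (x 31 * y 1 - x 1 * y 31),
    (x 14 * y 10 - x 10 * y 14) - (x 16 * y 13 - x 13 * y 16) + (x 18 * y 9 - x 9 * y 18) - (x 19 * y 5 - x 5 * y 19) - (x 21 * y 6 - x 6 * y 21) + (x 24 * y 6 - x 6 * y 24) + (x 28 * y 2 - x 2 * y 28) - (x 31 * y 1 - x 1 * y 31),
    -(x 15 * y 11 - x 11 * y 15) + (x 17 * y 12 - x 12 * y 17) - (x 18 * y 8 - x 8 * y 18) + (x 19 * y 4 - x 4 * y 19) - (x 23 * y 7 - x 7 * y 23) + (x 26 * y 7 - x 7 * y 26) - (x 29 * y 2 - x 2 * y 29) + (x 30 * y 1 - x 1 * y 30),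
    -(x 21 * y 11 - x 11 * y 21) - (x 22 * y 13 - x 13 * y 22) + (x 25 * y 12 - x 12 * y 25) + (x 26 * y 10 - x 10 * y 26) - (x 30 * y 4 - x 4 * y 30) + (x 31 * y 5 - x 5 * y 31) - (x 34 * y 0 - x 0 * y 34) + (x 35 * y 0 - x 0 * y 35),
    (x 22 * y 16 - x 16 * y 22) - (x 23 * y 14 - x 14 * y 23) + (x 24 * y 15 - x 15 * y 24) - (x 25 * y 17 - x 17 * y 25) - (x 28 * y 9 - x 9 * y 28) + (x 29 * y 8 - x 8 * y 29) - (x 32 * y 3 - x 3 * y 32) + (x 33 * y 3 - x 3 * y 33)] := by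
  rw [br_list]
  ext k
  fin_cases k <;> simp [u] <;> try ring

/-- Equations of the term `n^1` of the upper central series. -/
structure E1 (x : Fin 40 → ℂ) : Prop where
  a0 : x 0 = 0
  a1 : x 1 = 0
  a2 : x 2 = 0
  a3 : x 3 = 0
  a4 : x 4 = 0
  a5 : x 5 = 0
  a6 : x 6 = 0
  a7 : x 7 = 0
  a8 : x 8 = 0
  a9 : x 9 = 0
  a10 : x 10 = 0
  a11 : x 11 = 0
  a12 : x 12 = 0
  a13 : x 13 = 0
  a14 : x 14 = 0
  a15 : x 15 = 0
  a16 : x 16 = 0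
  a17 : x 17 = 0
  a18 : x 18 = 0
  a19 : x 19 = 0
  a21 : x 21 = 0
  a22 : x 22 = 0
  a23 : x 23 = 0
  a24 : x 24 = 0
  a25 : x 25 = 0
  a26 : x 26 = 0
  a28 : x 28 = 0
  a29 : x 29 = 0
  a30 : x 30 = 0
  a31 : x 31 = 0
  a32 : x 32 = x 33
  a34 : x 34 = x 35

/-- Equations of the term `n^2` of the upper central series. -/
structure E2 (x : Fin 40 → ℂ) : Prop where
  a0 : x 0 = 0
  a1 : x 1 = 0
  a2 : x 2 = 0
  a3 : x 3 = 0
  a4 : x 4 = 0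
  a5 : x 5 = 0
  a6 : x 6 = 0
  a7 : x 7 = 0
  a8 : x 8 = 0
  a9 : x 9 = 0
  a10 : x 10 = 0
  a11 : x 11 = 0
  a12 : x 12 = 0
  a13 : x 13 = 0
  a14 : x 14 = 0
  a15 : x 15 = 0
  a16 : x 16 = 0
  a17 : x 17 = 0
  a18 : x 18 = 0
  a19 : x 19 = 0
  a21 : x 21 = -x 26
  a22 : x 22 = -x 26
  a23 : x 23 = x 26
  a24 : x 24 = -x 26
  a25 : x 25 = x 26
  a28 : x 28 = -x 29
  a30 : x 30 = -x 31

/-- Equations of the term `n^3` of the upper central series. -/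
structure E3 (x : Fin 40 → ℂ) : Prop where
  a0 : x 0 = 0
  a1 : x 1 = 0
  a2 : x 2 = 0
  a3 : x 3 = 0
  a4 : x 4 = 0
  a5 : x 5 = 0
  a6 : x 6 = 0
  a7 : x 7 = 0
  a8 : x 8 = 0
  a9 : x 9 = 0
  a10 : x 10 = -x 13
  a11 : x 11 = -x 13
  a12 : x 12 = x 13
  a14 : x 14 = -x 17
  a15 : x 15 = -x 17
  a16 : x 16 = x 17
  a21 : x 21 = -x 23 + x 24 + x 26
  a22 : x 22 = -x 23 + x 24 + x 25

/-- Equations of the term `n^4` of the upper central series. -/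
structure E4 (x : Fin 40 → ℂ) : Prop where
  a0 : x 0 = 0
  a1 : x 1 = 0
  a2 : x 2 = 0
  a3 : x 3 = 0
  a4 : x 4 = -x 5
  a6 : x 6 = -x 7
  a8 : x 8 = -x 9
  a10 : x 10 = -x 11 - x 12 - x 13
  a14 : x 14 = -x 15 - x 16 - x 17

set_option linter.unreachableTactic false
set_option linter.unusedTactic false
set_option linter.unusedSimpArgs false

set_option maxHeartbeats 0 in
theorem mem_ucs1 (x : Fin 40 → ℂ) : x ∈ ucs 1 ↔ E1 x := by
  have h0 : x ∈ ucs 1 ↔ ∀ y, br x y = 0 := Iff.rfl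
  rw [h0]
  constructor
  · intro h
    have e0 := congrFun (h (Pi.single 0 1)) 4
    have e1 := congrFun (h (Pi.single 1 1)) 4
    have e2 := congrFun (h (Pi.single 1 1)) 6
    have e3 := congrFun (h (Pi.single 2 1)) 8
    have e4 := congrFun (h (Pi.single 0 1)) 10
    have e5 := congrFun (h (Pi.single 2 1)) 10
    have e6 := congrFun (h (Pi.single 0 1)) 11
    have e7 := congrFun (h (Pi.single 2 1)) 11
    have e8 := congrFun (h (Pi.single 1 1)) 14
    have e9 := congrFun (h (Pi.single 1 1)) 15
    have e10 := congrFun (h (Pi.single 0 1)) 20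
    have e11 := congrFun (h (Pi.single 3 1)) 20
    have e12 := congrFun (h (Pi.single 0 1)) 21
    have e13 := congrFun (h (Pi.single 0 1)) 22
    have e14 := congrFun (h (Pi.single 3 1)) 22
    have e15 := congrFun (h (Pi.single 0 1)) 23
    have e16 := congrFun (h (Pi.single 3 1)) 24
    have e17 := congrFun (h (Pi.single 3 1)) 26
    have e18 := congrFun (h (Pi.single 3 1)) 28
    have e19 := congrFun (h (Pi.single 0 1)) 30
    have e20 := congrFun (h (Pi.single 2 1)) 32
    have e21 := congrFun (h (Pi.single 6 1)) 32
    have e22 := congrFun (h (Pi.single 7 1)) 32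
    have e23 := congrFun (h (Pi.single 2 1)) 33
    have e24 := congrFun (h (Pi.single 6 1)) 33
    have e25 := congrFun (h (Pi.single 7 1)) 33
    have e26 := congrFun (h (Pi.single 1 1)) 34
    have e27 := congrFun (h (Pi.single 6 1)) 34
    have e28 := congrFun (h (Pi.single 1 1)) 35
    have e29 := congrFun (h (Pi.single 7 1)) 35
    have e30 := congrFun (h (Pi.single 0 1)) 38
    have e31 := congrFun (h (Pi.single 3 1)) 39
    simp [br_eq] at e0 e1 e2 e3 e4 e5 e6 e7 e8 e9 e10 e11
    simp [br_eq] at e12 e13 e14 e15 e16 e17 e18 e19 e20 e21 e22 e23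
    simp [br_eq] at e24 e25 e26 e27 e28 e29 e30 e31
    constructor <;> grind
  · intro h y
    rw [br_eq]
    ext k
    fin_cases k <;> simp [
      h.a0, h.a1, h.a2, h.a3, h.a4, h.a5, h.a6, h.a7, h.a8, h.a9, h.a10, h.a11, h.a12, h.a13,
      h.a14, h.a15, h.a16, h.a17, h.a18, h.a19, h.a21, h.a22, h.a23, h.a24, h.a25, h.a26,
      h.a28, h.a29, h.a30, h.a31, h.a32, h.a34] <;> try ring

/-- Parametrization of `n^1`. -/
def par1 : (Fin 8 → ℂ) →ₗ[ℂ] (Fin 40 → ℂ) where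
  toFun t := ![
    0, 0, 0, 0, 0, 0, 0, 0, 0, 0, 0, 0, 0, 0, 0, 0, 0, 0, 0, 0, t 0, 0, 0, 0, 0, 0, 0, t 1, 0,
    0, 0, 0, t 2, t 2, t 3, t 3, t 4, t 5, t 6, t 7]
  map_add' s t := by
    ext k
    fin_cases k <;> simp <;> try ring
  map_smul' a t := by
    ext k
    fin_cases k <;> simp <;> try ring

theorem par1_inj : Function.Injective par1 := by
  intro s t h
  ext i
  fin_cases i
  · simpa [par1] using congrFun h 20
  · simpa [par1] using congrFun h 27
  · simpa [par1] using congrFun h 33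
  · simpa [par1] using congrFun h 35
  · simpa [par1] using congrFun h 36
  · simpa [par1] using congrFun h 37
  · simpa [par1] using congrFun h 38
  · simpa [par1] using congrFun h 39

theorem ucs1_eq : ucs 1 = (LinearMap.range par1 : Set (Fin 40 → ℂ)) := by
  ext x
  rw [mem_ucs1, SetLike.mem_coe, LinearMap.mem_range]
  constructor
  · intro h
    refine ⟨![x 20, x 27, x 33, x 35, x 36, x 37, x 38, x 39], ?_⟩
    ext k
    fin_cases k <;> simp [par1,
      h.a0, h.a1, h.a2, h.a3, h.a4, h.a5, h.a6, h.a7, h.a8, h.a9, h.a10, h.a11, h.a12, h.a13,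
      h.a14, h.a15, h.a16, h.a17, h.a18, h.a19, h.a21, h.a22, h.a23, h.a24, h.a25, h.a26,
      h.a28, h.a29, h.a30, h.a31, h.a32, h.a34] <;> try ring
  · rintro ⟨t, rfl⟩
    constructor <;> simp [par1] <;> try ring

theorem ucs1_finrank : Set.finrank ℂ (ucs 1) = 8 := by
  rw [Set.finrank, ucs1_eq, Submodule.span_eq, LinearMap.finrank_range_of_inj par1_inj]
  simp

set_option maxHeartbeats 0 in
theorem mem_ucs2 (x : Fin 40 → ℂ) : x ∈ ucs 2 ↔ E2 x := by
  have h0 : x ∈ ucs 2 ↔ ∀ y, E1 (br x y) := forall_congr' fun y => mem_ucs1 _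
  rw [h0]
  constructor
  · intro h
    have e0 := (h (Pi.single 0 1)).a4
    have e1 := (h (Pi.single 1 1)).a4
    have e2 := (h (Pi.single 1 1)).a6
    have e3 := (h (Pi.single 2 1)).a8
    have e4 := (h (Pi.single 0 1)).a10
    have e5 := (h (Pi.single 2 1)).a10
    have e6 := (h (Pi.single 0 1)).a11
    have e7 := (h (Pi.single 2 1)).a11
    have e8 := (h (Pi.single 1 1)).a14
    have e9 := (h (Pi.single 1 1)).a15
    have e10 := (h (Pi.single 0 1)).a21
    have e11 := (h (Pi.single 3 1)).a21
    have e12 := (h (Pi.single 0 1)).a22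
    have e13 := (h (Pi.single 3 1)).a22
    have e14 := (h (Pi.single 0 1)).a23
    have e15 := (h (Pi.single 0 1)).a24
    have e16 := (h (Pi.single 3 1)).a24
    have e17 := (h (Pi.single 3 1)).a26
    have e18 := (h (Pi.single 3 1)).a28
    have e19 := (h (Pi.single 0 1)).a30
    have e20 := (h (Pi.single 1 1)).a28
    have e21 := (h (Pi.single 1 1)).a29
    have e22 := (h (Pi.single 2 1)).a30
    have e23 := (h (Pi.single 2 1)).a31
    have e24 := (h (Pi.single 2 1)).a32
    have e25 := (h (Pi.single 6 1)).a32
    have e26 := (h (Pi.single 1 1)).a34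
    simp [br_eq] at e0 e1 e2 e3 e4 e5 e6 e7 e8 e9 e10 e11
    simp [br_eq] at e12 e13 e14 e15 e16 e17 e18 e19 e20 e21 e22 e23
    simp [br_eq] at e24 e25 e26
    constructor <;> grind
  · intro h y
    rw [br_eq]
    constructor <;> simp [
      h.a0, h.a1, h.a2, h.a3, h.a4, h.a5, h.a6, h.a7, h.a8, h.a9, h.a10, h.a11, h.a12, h.a13,
      h.a14, h.a15, h.a16, h.a17, h.a18, h.a19, h.a21, h.a22, h.a23, h.a24, h.a25, h.a28, h.a30] <;> try ring

/-- Parametrization of `n^2`. -/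
def par2 : (Fin 13 → ℂ) →ₗ[ℂ] (Fin 40 → ℂ) where
  toFun t := ![
    0, 0, 0, 0, 0, 0, 0, 0, 0, 0, 0, 0, 0, 0, 0, 0, 0, 0, 0, 0, t 0, -t 1, -t 1, t 1, -t 1,
    t 1, t 1, t 2, -t 3, t 3, -t 4, t 4, t 5, t 6, t 7, t 8, t 9, t 10, t 11, t 12]
  map_add' s t := by
    ext k
    fin_cases k <;> simp <;> try ring
  map_smul' a t := by
    ext k
    fin_cases k <;> simp <;> try ring

theorem par2_inj : Function.Injective par2 := by
  intro s t h
  ext i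
  fin_cases i
  · simpa [par2] using congrFun h 20
  · simpa [par2] using congrFun h 26
  · simpa [par2] using congrFun h 27
  · simpa [par2] using congrFun h 29
  · simpa [par2] using congrFun h 31
  · simpa [par2] using congrFun h 32
  · simpa [par2] using congrFun h 33
  · simpa [par2] using congrFun h 34
  · simpa [par2] using congrFun h 35
  · simpa [par2] using congrFun h 36
  · simpa [par2] using congrFun h 37
  · simpa [par2] using congrFun h 38
  · simpa [par2] using congrFun h 39

theorem ucs2_eq : ucs 2 = (LinearMap.range par2 : Set (Fin 40 → ℂ)) := by
  ext x
  rw [mem_ucs2, SetLike.mem_coe, LinearMap.mem_range]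
  constructor
  · intro h
    refine ⟨![x 20, x 26, x 27, x 29, x 31, x 32, x 33, x 34, x 35, x 36, x 37, x 38, x 39], ?_⟩
    ext k
    fin_cases k <;> simp [par2,
      h.a0, h.a1, h.a2, h.a3, h.a4, h.a5, h.a6, h.a7, h.a8, h.a9, h.a10, h.a11, h.a12, h.a13,
      h.a14, h.a15, h.a16, h.a17, h.a18, h.a19, h.a21, h.a22, h.a23, h.a24, h.a25, h.a28, h.a30] <;> try ring
  · rintro ⟨t, rfl⟩
    constructor <;> simp [par2] <;> try ring

theorem ucs2_finrank : Set.finrank ℂ (ucs 2) = 13 := by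
  rw [Set.finrank, ucs2_eq, Submodule.span_eq, LinearMap.finrank_range_of_inj par2_inj]
  simp

set_option maxHeartbeats 0 in
theorem mem_ucs3 (x : Fin 40 → ℂ) : x ∈ ucs 3 ↔ E3 x := by
  have h0 : x ∈ ucs 3 ↔ ∀ y, E2 (br x y) := forall_congr' fun y => mem_ucs2 _
  rw [h0]
  constructor
  · intro h
    have e0 := (h (Pi.single 0 1)).a4
    have e1 := (h (Pi.single 1 1)).a4
    have e2 := (h (Pi.single 1 1)).a6
    have e3 := (h (Pi.single 2 1)).a8
    have e4 := (h (Pi.single 0 1)).a10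
    have e5 := (h (Pi.single 2 1)).a10
    have e6 := (h (Pi.single 0 1)).a11
    have e7 := (h (Pi.single 2 1)).a11
    have e8 := (h (Pi.single 1 1)).a14
    have e9 := (h (Pi.single 1 1)).a15
    have e10 := (h (Pi.single 1 1)).a18
    have e11 := (h (Pi.single 2 1)).a19
    have e12 := (h (Pi.single 3 1)).a21
    have e13 := (h (Pi.single 3 1)).a22
    have e14 := (h (Pi.single 0 1)).a23
    have e15 := (h (Pi.single 0 1)).a24
    have e16 := (h (Pi.single 1 1)).a28
    have e17 := (h (Pi.single 2 1)).a30
    simp [br_eq] at e0 e1 e2 e3 e4 e5 e6 e7 e8 e9 e10 e11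
    simp [br_eq] at e12 e13 e14 e15 e16 e17
    constructor <;> grind
  · intro h y
    rw [br_eq]
    constructor <;> simp [
      h.a0, h.a1, h.a2, h.a3, h.a4, h.a5, h.a6, h.a7, h.a8, h.a9, h.a10, h.a11, h.a12, h.a14,
      h.a15, h.a16, h.a21, h.a22] <;> try ring

/-- Parametrization of `n^3`. -/
def par3 : (Fin 22 → ℂ) →ₗ[ℂ] (Fin 40 → ℂ) where
  toFun t := ![
    0, 0, 0, 0, 0, 0, 0, 0, 0, 0, -t 0, -t 0, t 0, t 0, -t 1, -t 1, t 1, t 1, t 2, t 3, t 4,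
    -t 5 + t 6 + t 8, -t 5 + t 6 + t 7, t 5, t 6, t 7, t 8, t 9, t 10, t 11, t 12, t 13, t 14,
    t 15, t 16, t 17, t 18, t 19, t 20, t 21]
  map_add' s t := by
    ext k
    fin_cases k <;> simp <;> try ring
  map_smul' a t := by
    ext k
    fin_cases k <;> simp <;> try ring

theorem par3_inj : Function.Injective par3 := by
  intro s t h
  ext i
  fin_cases i
  · simpa [par3] using congrFun h 13
  · simpa [par3] using congrFun h 17
  · simpa [par3] using congrFun h 18
  · simpa [par3] using congrFun h 19
  · simpa [par3] using congrFun h 20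
  · simpa [par3] using congrFun h 23
  · simpa [par3] using congrFun h 24
  · simpa [par3] using congrFun h 25
  · simpa [par3] using congrFun h 26
  · simpa [par3] using congrFun h 27
  · simpa [par3] using congrFun h 28
  · simpa [par3] using congrFun h 29
  · simpa [par3] using congrFun h 30
  · simpa [par3] using congrFun h 31
  · simpa [par3] using congrFun h 32
  · simpa [par3] using congrFun h 33
  · simpa [par3] using congrFun h 34
  · simpa [par3] using congrFun h 35
  · simpa [par3] using congrFun h 36
  · simpa [par3] using congrFun h 37
  · simpa [par3] using congrFun h 38
  · simpa [par3] using congrFun h 39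

theorem ucs3_eq : ucs 3 = (LinearMap.range par3 : Set (Fin 40 → ℂ)) := by
  ext x
  rw [mem_ucs3, SetLike.mem_coe, LinearMap.mem_range]
  constructor
  · intro h
    refine ⟨![x 13, x 17, x 18, x 19, x 20, x 23, x 24, x 25, x 26, x 27, x 28, x 29, x 30, x 31, x 32, x 33, x 34, x 35, x 36, x 37, x 38, x 39], ?_⟩
    ext k
    fin_cases k <;> simp [par3,
      h.a0, h.a1, h.a2, h.a3, h.a4, h.a5, h.a6, h.a7, h.a8, h.a9, h.a10, h.a11, h.a12, h.a14,
      h.a15, h.a16, h.a21, h.a22] <;> try ring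
  · rintro ⟨t, rfl⟩
    constructor <;> simp [par3] <;> try ring

theorem ucs3_finrank : Set.finrank ℂ (ucs 3) = 22 := by
  rw [Set.finrank, ucs3_eq, Submodule.span_eq, LinearMap.finrank_range_of_inj par3_inj]
  simp

set_option maxHeartbeats 0 in
theorem mem_ucs4 (x : Fin 40 → ℂ) : x ∈ ucs 4 ↔ E4 x := by
  have h0 : x ∈ ucs 4 ↔ ∀ y, E3 (br x y) := forall_congr' fun y => mem_ucs3 _
  rw [h0]
  constructor
  · intro h
    have e0 := (h (Pi.single 0 1)).a4
    have e1 := (h (Pi.single 1 1)).a4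
    have e2 := (h (Pi.single 1 1)).a6
    have e3 := (h (Pi.single 2 1)).a8
    have e4 := (h (Pi.single 2 1)).a10
    have e5 := (h (Pi.single 0 1)).a11
    have e6 := (h (Pi.single 1 1)).a15
    have e7 := (h (Pi.single 0 1)).a21
    have e8 := (h (Pi.single 3 1)).a21
    simp [br_eq] at e0 e1 e2 e3 e4 e5 e6 e7 e8
    constructor <;> grind
  · intro h y
    rw [br_eq]
    constructor <;> simp [
      h.a0, h.a1, h.a2, h.a3, h.a4, h.a6, h.a8, h.a10, h.a14] <;> try ring

/-- Parametrization of `n^4`. -/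
def par4 : (Fin 31 → ℂ) →ₗ[ℂ] (Fin 40 → ℂ) where
  toFun t := ![
    0, 0, 0, 0, -t 0, t 0, -t 1, t 1, -t 2, t 2, -t 3 - t 4 - t 5, t 3, t 4, t 5,
    -t 6 - t 7 - t 8, t 6, t 7, t 8, t 9, t 10, t 11, t 12, t 13, t 14, t 15, t 16, t 17, t 18,
    t 19, t 20, t 21, t 22, t 23, t 24, t 25, t 26, t 27, t 28, t 29, t 30]
  map_add' s t := by
    ext k
    fin_cases k <;> simp <;> try ring
  map_smul' a t := by
    ext k
    fin_cases k <;> simp <;> try ring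

theorem par4_inj : Function.Injective par4 := by
  intro s t h
  ext i
  fin_cases i
  · simpa [par4] using congrFun h 5
  · simpa [par4] using congrFun h 7
  · simpa [par4] using congrFun h 9
  · simpa [par4] using congrFun h 11
  · simpa [par4] using congrFun h 12
  · simpa [par4] using congrFun h 13
  · simpa [par4] using congrFun h 15
  · simpa [par4] using congrFun h 16
  · simpa [par4] using congrFun h 17
  · simpa [par4] using congrFun h 18
  · simpa [par4] using congrFun h 19
  · simpa [par4] using congrFun h 20
  · simpa [par4] using congrFun h 21
  · simpa [par4] using congrFun h 22
  · simpa [par4] using congrFun h 23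
  · simpa [par4] using congrFun h 24
  · simpa [par4] using congrFun h 25
  · simpa [par4] using congrFun h 26
  · simpa [par4] using congrFun h 27
  · simpa [par4] using congrFun h 28
  · simpa [par4] using congrFun h 29
  · simpa [par4] using congrFun h 30
  · simpa [par4] using congrFun h 31
  · simpa [par4] using congrFun h 32
  · simpa [par4] using congrFun h 33
  · simpa [par4] using congrFun h 34
  · simpa [par4] using congrFun h 35
  · simpa [par4] using congrFun h 36
  · simpa [par4] using congrFun h 37
  · simpa [par4] using congrFun h 38
  · simpa [par4] using congrFun h 39

theorem ucs4_eq : ucs 4 = (LinearMap.range par4 : Set (Fin 40 → ℂ)) := by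
  ext x
  rw [mem_ucs4, SetLike.mem_coe, LinearMap.mem_range]
  constructor
  · intro h
    refine ⟨![x 5, x 7, x 9, x 11, x 12, x 13, x 15, x 16, x 17, x 18, x 19, x 20, x 21, x 22, x 23, x 24, x 25, x 26, x 27, x 28, x 29, x 30, x 31, x 32, x 33, x 34, x 35, x 36, x 37, x 38, x 39], ?_⟩
    ext k
    fin_cases k <;> simp [par4,
      h.a0, h.a1, h.a2, h.a3, h.a4, h.a6, h.a8, h.a10, h.a14] <;> try ring
  · rintro ⟨t, rfl⟩
    constructor <;> simp [par4] <;> try ring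

theorem ucs4_finrank : Set.finrank ℂ (ucs 4) = 31 := by
  rw [Set.finrank, ucs4_eq, Submodule.span_eq, LinearMap.finrank_range_of_inj par4_inj]
  simp

theorem ucs5_eq : ucs 5 = Set.univ := by
  refine Set.eq_univ_of_forall fun x => ?_
  have h0 : x ∈ ucs 5 ↔ ∀ y, E4 (br x y) := forall_congr' fun y => mem_ucs4 _
  rw [h0]
  intro y
  rw [br_eq]
  constructor <;> simp <;> try ring

theorem ucs1_span : ucs 1 = ↑(Submodule.span ℂ
    ({u 40, u 39, u 38, u 37, u 35 + u 36, u 33 + u 34, u 28, u 21} : Set (Fin 40 → ℂ))) := by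
  apply Set.Subset.antisymm
  · intro x hx
    rw [mem_ucs1] at hx
    have e : x = x 39 • u 40 + x 38 • u 39 + x 37 • u 38 + x 36 • u 37 + x 35 • (u 35 + u 36)
        + x 33 • (u 33 + u 34) + x 27 • u 28 + x 20 • u 21 := by
      ext k
      fin_cases k <;> simp [u, 
        hx.a0, hx.a1, hx.a2, hx.a3, hx.a4, hx.a5, hx.a6, hx.a7, hx.a8, hx.a9, hx.a10, hx.a11,
        hx.a12, hx.a13, hx.a14, hx.a15, hx.a16, hx.a17, hx.a18, hx.a19, hx.a21, hx.a22, hx.a23,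
        hx.a24, hx.a25, hx.a26, hx.a28, hx.a29, hx.a30, hx.a31, hx.a32, hx.a34]
    rw [e]
    simp only [SetLike.mem_coe]
    repeat' apply Submodule.add_mem
    all_goals exact Submodule.smul_mem _ _ (Submodule.subset_span (by simp))
  · rw [ucs1_eq, SetLike.coe_subset_coe, Submodule.span_le, ← ucs1_eq]
    intro x hx
    simp only [Set.mem_insert_iff, Set.mem_singleton_iff] at hx
    rw [mem_ucs1]
    rcases hx with rfl | rfl | rfl | rfl | rfl | rfl | rfl | rfl <;> constructor <;> simp [u]

theorem stmt_12 :
    ucs 1 = ↑(Submodule.span ℂ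
      ({u 40, u 39, u 38, u 37, u 35 + u 36, u 33 + u 34, u 28, u 21} : Set (Fin 40 → ℂ))) ∧
    Set.finrank ℂ (ucs 1) = 8 ∧
    Set.finrank ℂ (ucs 2) = 13 ∧
    Set.finrank ℂ (ucs 3) = 22 ∧
    Set.finrank ℂ (ucs 4) = 31 ∧
    ucs 5 = Set.univ := by
  exact ⟨ucs1_span, ucs1_finrank, ucs2_finrank, ucs3_finrank, ucs4_finrank, ucs5_eq⟩
end
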